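/- Let n = 2m be even and let P ∈ ℂ[x] be a polynomial of degree n that is real on the imaginary axis and has leading coefficient (−1)^m. If P has a root α with |Re α| < 1, then the regular bimodule 𝒜(P) is unitarizable, i.e. there exists a positive definite invariant Hermitian form on 𝒜(P). -/

import Mathlib

open Polynomial
open scoped Classical

noncomputable section

abbrev FA : Type := FreeAlgebra ℂ (Fin 3)

def Egen : FA := FreeAlgebra.ι ℂ 0
def Fgen : FA := FreeAlgebra.ι ℂ 1
def Hgen : FA := FreeAlgebra.ι ℂ 2

/-- The defining relations of the deformation `𝒜(P)` of the type A Kleinian singularity: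
`he − eh = 2e`, `hf − fh = −2f`, `ef = P(h−1)`, `fe = P(h+1)`. -/
inductive ARel (P : ℂ[X]) : FA → FA → Prop
  | he : ARel P (Hgen * Egen - Egen * Hgen) (2 * Egen)
  | hf : ARel P (Hgen * Fgen - Fgen * Hgen) (-(2 * Fgen))
  | ef : ARel P (Egen * Fgen) (Polynomial.aeval (Hgen - 1) P)
  | fe : ARel P (Fgen * Egen) (Polynomial.aeval (Hgen + 1) P)

/-- The algebra `𝒜(P)`. -/
abbrev AP (P : ℂ[X]) : Type := RingQuot (ARel P)

def eA (P : ℂ[X]) : AP P := RingQuot.mkAlgHom ℂ (ARel P) Egen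
def fA (P : ℂ[X]) : AP P := RingQuot.mkAlgHom ℂ (ARel P) Fgen
def hA (P : ℂ[X]) : AP P := RingQuot.mkAlgHom ℂ (ARel P) Hgen

/-- `P` is real on the imaginary axis: `P(it) ∈ ℝ` for all real `t`. -/
def RealOnIm (P : ℂ[X]) : Prop := ∀ t : ℝ, ∃ r : ℝ, P.eval (Complex.I * t) = r

/-- An invariant Hermitian (sesquilinear) form on the regular bimodule `𝒜(P)`. -/
structure InvForm (P : ℂ[X]) where
  B : AP P → AP P → ℂ
  add_left : ∀ u v w, B (u + v) w = B u w + B v w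
  smul_left : ∀ (c : ℂ) (u v), B (c • u) v = c * B u v
  conj_symm : ∀ u v, B u v = starRingEnd ℂ (B v u)
  e_left : ∀ u v, B (eA P * u) v = - B u (v * fA P)
  h_left : ∀ u v, B (hA P * u) v = - B u (v * hA P)
  f_left : ∀ u v, B (fA P * u) v = - B u (v * eA P)
  e_right : ∀ u v, B (u * eA P) v = - B u (fA P * v)
  h_right : ∀ u v, B (u * hA P) v = - B u (hA P * v)
  f_right : ∀ u v, B (u * fA P) v = - B u (eA P * v)

/-- The regular bimodule `𝒜(P)` is unitarizable: there is a positive definite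
invariant Hermitian form on it. -/
def Unitarizable (P : ℂ[X]) : Prop :=
  ∃ Φ : InvForm P, ∀ u : AP P, u ≠ 0 → ∃ r : ℝ, 0 < r ∧ Φ.B u u = r

/-! ### The involution `R ↦ R̄(-x)` on polynomials -/

/-- The antilinear involution `R(x) ↦ R̄(-x)`. -/
def pstar : ℂ[X] →+* ℂ[X] :=
  (compRingHom (-X)).comp (mapRingHom (starRingEnd ℂ))

lemma pstar_apply (R : ℂ[X]) : pstar R = (R.map (starRingEnd ℂ)).comp (-X) := rfl

lemma eval_pstar (R : ℂ[X]) (z : ℂ) :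
    (pstar R).eval z = starRingEnd ℂ (R.eval (-starRingEnd ℂ z)) := by
  rw [pstar_apply, eval_comp, eval_map, ← eval₂_hom]
  simp

lemma pstar_pstar (R : ℂ[X]) : pstar (pstar R) = R := by
  refine Polynomial.funext fun z => ?_
  simp [eval_pstar]

lemma pstar_C (c : ℂ) : pstar (C c) = C (starRingEnd ℂ c) := by simp [pstar_apply]

lemma pstar_X : pstar X = -X := by simp [pstar_apply]

lemma pstar_comp (R S : ℂ[X]) : pstar (R.comp S) = (pstar R).comp (-pstar S) := by
  refine Polynomial.funext fun z => ?_
  simp [eval_pstar]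

/-- A polynomial real on the imaginary axis is fixed by `pstar`. -/
lemma RealOnIm.pstar_eq {P : ℂ[X]} (hP : RealOnIm P) : pstar P = P := by
  refine Polynomial.eq_of_infinite_eval_eq _ _ ?_
  refine Set.Infinite.mono (s := Set.range fun t : ℝ => Complex.I * (t : ℂ)) ?_
    (Set.infinite_range_of_injective ?_)
  · rintro _ ⟨t, rfl⟩
    obtain ⟨r, hr⟩ := hP t
    simp [eval_pstar, hr]
  · intro s t h
    simpa using h

/-! ### Structure of the algebra `𝒜(P)` -/

section Structure

variable (P : ℂ[X])

/-- Evaluation of polynomials at `h`. -/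
def polyH : ℂ[X] →ₐ[ℂ] AP P := aeval (hA P)

lemma polyH_X : polyH P X = hA P := by simp [polyH]

lemma hA_mul_eA : hA P * eA P = eA P * (hA P + 2) := by
  have h := RingQuot.mkAlgHom_rel ℂ (ARel.he (P := P))
  simp only [map_sub, map_mul, map_ofNat] at h
  change hA P * eA P - eA P * hA P = 2 * eA P at h
  rw [sub_eq_iff_eq_add] at h
  rw [h, mul_add, mul_two, two_mul, add_comm]

lemma hA_mul_fA : hA P * fA P = fA P * (hA P - 2) := by
  have h := RingQuot.mkAlgHom_rel ℂ (ARel.hf (P := P))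
  simp only [map_sub, map_mul, map_neg, map_ofNat] at h
  change hA P * fA P - fA P * hA P = -(2 * fA P) at h
  rw [sub_eq_iff_eq_add] at h
  rw [h, mul_sub, mul_two, two_mul]
  abel

lemma eA_mul_fA : eA P * fA P = polyH P (P.comp (X - C 1)) := by
  have h := RingQuot.mkAlgHom_rel ℂ (ARel.ef (P := P))
  rw [map_mul, ← aeval_algHom_apply, map_sub, map_one] at h
  change eA P * fA P = aeval (hA P - 1) P at h
  rw [h, polyH, aeval_comp]
  simp

lemma fA_mul_eA : fA P * eA P = polyH P (P.comp (X + C 1)) := by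
  have h := RingQuot.mkAlgHom_rel ℂ (ARel.fe (P := P))
  rw [map_mul, ← aeval_algHom_apply, map_add, map_one] at h
  change fA P * eA P = aeval (hA P + 1) P at h
  rw [h, polyH, aeval_comp]
  simp

lemma eA_mul_polyH (R : ℂ[X]) : eA P * polyH P R = polyH P (R.comp (X - C 2)) * eA P := by
  induction R using Polynomial.induction_on' with
  | add p q hp hq => simp only [map_add, mul_add, add_comp, add_mul, hp, hq]
  | monomial n a =>
    induction n with
    | zero => simpa [polyH] using (Algebra.commutes a (eA P)).symm
    | succ n ih =>
      rw [← monomial_mul_X, map_mul, ← mul_assoc, ih, mul_comp, map_mul, mul_assoc, mul_assoc,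
        polyH_X, X_comp, map_sub, polyH_X]
      congr 1
      have h2 : polyH P (C 2) = 2 := by rw [show (C 2 : ℂ[X]) = 2 from rfl, map_ofNat]
      rw [h2, sub_mul, hA_mul_eA, mul_add, mul_two, two_mul]
      abel

lemma fA_mul_polyH (R : ℂ[X]) : fA P * polyH P R = polyH P (R.comp (X + C 2)) * fA P := by
  induction R using Polynomial.induction_on' with
  | add p q hp hq => simp only [map_add, mul_add, add_comp, add_mul, hp, hq]
  | monomial n a =>
    induction n with
    | zero => simpa [polyH] using (Algebra.commutes a (fA P)).symm
    | succ n ih =>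
      rw [← monomial_mul_X, map_mul, ← mul_assoc, ih, mul_comp, map_mul, mul_assoc, mul_assoc,
        polyH_X, X_comp, map_add, polyH_X]
      congr 1
      have h2 : polyH P (C 2) = 2 := by rw [show (C 2 : ℂ[X]) = 2 from rfl, map_ofNat]
      rw [h2, add_mul, hA_mul_fA, mul_sub, mul_two, two_mul]
      abel

lemma eA_polyH_fA (R : ℂ[X]) :
    eA P * polyH P R * fA P = polyH P (R.comp (X - C 2) * P.comp (X - C 1)) := by
  rw [eA_mul_polyH, mul_assoc, eA_mul_fA, map_mul]

lemma fA_polyH_eA (R : ℂ[X]) :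
    fA P * polyH P R * eA P = polyH P (R.comp (X + C 2) * P.comp (X + C 1)) := by
  rw [fA_mul_polyH, mul_assoc, fA_mul_eA, map_mul]

/-- Induction principle: `𝒜(P)` is generated by `e`, `f`, `h`. -/
lemma AP.induction {p : AP P → Prop} (hsc : ∀ c : ℂ, p (algebraMap ℂ (AP P) c))
    (he : p (eA P)) (hf : p (fA P)) (hh : p (hA P))
    (hadd : ∀ a b, p a → p b → p (a + b)) (hmul : ∀ a b, p a → p b → p (a * b)) (a : AP P) :
    p a := by
  obtain ⟨x, rfl⟩ := RingQuot.mkAlgHom_surjective ℂ (ARel P) a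
  induction x using FreeAlgebra.induction with
  | grade0 c => simpa using hsc c
  | grade1 i => fin_cases i <;> assumption
  | mul a b ha hb => rw [map_mul]; exact hmul _ _ ha hb
  | add a b ha hb => rw [map_add]; exact hadd _ _ ha hb

/-- `e ^ k` for `k ≥ 0` and `f ^ (-k)` for `k < 0`. -/
def gradedGen (k : ℤ) : AP P :=
  if 0 ≤ k then eA P ^ k.toNat else fA P ^ (-k).toNat

lemma gradedGen_natCast (n : ℕ) : gradedGen P n = eA P ^ n := by simp [gradedGen]

lemma gradedGen_neg_natCast (n : ℕ) : gradedGen P (-n) = fA P ^ n := by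
  rcases n with _ | n
  · simp [gradedGen]
  · have h : ¬ (0 ≤ -((n + 1 : ℕ) : ℤ)) := by omega
    rw [gradedGen, if_neg h, neg_neg, Int.toNat_natCast]

lemma eA_mul_gradedGen (k : ℤ) : ∃ Q : ℂ[X], eA P * gradedGen P k =
    polyH P Q * gradedGen P (k + 1) := by
  obtain ⟨n, rfl | rfl⟩ := k.eq_nat_or_neg
  · refine ⟨1, ?_⟩
    rw [← Nat.cast_succ, gradedGen_natCast, gradedGen_natCast, map_one, one_mul, pow_succ']
  · rcases n with _ | n
    · exact ⟨1, by simp [gradedGen]⟩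
    · refine ⟨P.comp (X - C 1), ?_⟩
      have h : -((n + 1 : ℕ) : ℤ) + 1 = -(n : ℤ) := by push_cast; ring
      rw [h, gradedGen_neg_natCast, gradedGen_neg_natCast, pow_succ', ← mul_assoc, eA_mul_fA]

lemma fA_mul_gradedGen (k : ℤ) : ∃ Q : ℂ[X], fA P * gradedGen P k =
    polyH P Q * gradedGen P (k - 1) := by
  obtain ⟨n, rfl | rfl⟩ := k.eq_nat_or_neg
  · rcases n with _ | n
    · exact ⟨1, by simp [gradedGen]⟩
    · refine ⟨P.comp (X + C 1), ?_⟩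
      have h : ((n + 1 : ℕ) : ℤ) - 1 = (n : ℤ) := by push_cast; ring
      rw [h, gradedGen_natCast, gradedGen_natCast, pow_succ', ← mul_assoc, fA_mul_eA]
  · refine ⟨1, ?_⟩
    have h : -(n : ℤ) - 1 = -((n + 1 : ℕ) : ℤ) := by push_cast; ring
    rw [h, gradedGen_neg_natCast, gradedGen_neg_natCast, map_one, one_mul, pow_succ']

/-- Every element of `𝒜(P)` is a finite sum of elements `R(h) e ^ k`, `R(h) f ^ k`. -/
lemma exists_finsupp_eq (a : AP P) :
    ∃ c : ℤ →₀ ℂ[X], a = c.sum fun k R => polyH P R * gradedGen P k := by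
  let L : (ℤ →₀ ℂ[X]) →ₗ[ℂ] AP P := Finsupp.lsum ℂ fun k =>
    (LinearMap.mulRight ℂ (gradedGen P k)).comp (polyH P).toLinearMap
  suffices h : ∀ b ∈ LinearMap.range L, a * b ∈ LinearMap.range L by
    have h1 : (1 : AP P) ∈ LinearMap.range L :=
      ⟨Finsupp.single 0 1, by simp [L, gradedGen]⟩
    obtain ⟨c, hc⟩ := h 1 h1
    exact ⟨c, by rw [mul_one] at hc; exact hc.symm⟩
  have hmem : ∀ k R, polyH P R * gradedGen P k ∈ LinearMap.range L := fun k R =>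
    ⟨Finsupp.single k R, by simp [L]⟩
  have hgen : ∀ x : AP P, (∀ k R, x * (polyH P R * gradedGen P k) ∈ LinearMap.range L) →
      ∀ b ∈ LinearMap.range L, x * b ∈ LinearMap.range L := by
    rintro x hx _ ⟨c, rfl⟩
    change x * (c.sum fun k R => polyH P R * gradedGen P k) ∈ _
    rw [Finsupp.sum, Finset.mul_sum]
    exact Submodule.sum_mem _ fun k _ => hx k _
  induction a using AP.induction with
  | hsc c =>
    intro b hb
    rw [← Algebra.smul_def]
    exact Submodule.smul_mem _ _ hb
  | he =>
    refine hgen _ fun k R => ?_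
    obtain ⟨Q, hQ⟩ := eA_mul_gradedGen P k
    rw [← mul_assoc, eA_mul_polyH, mul_assoc, hQ, ← mul_assoc, ← map_mul]
    exact hmem _ _
  | hf =>
    refine hgen _ fun k R => ?_
    obtain ⟨Q, hQ⟩ := fA_mul_gradedGen P k
    rw [← mul_assoc, fA_mul_polyH, mul_assoc, hQ, ← mul_assoc, ← map_mul]
    exact hmem _ _
  | hh =>
    refine hgen _ fun k R => ?_
    rw [← mul_assoc, ← polyH_X, ← map_mul]
    exact hmem _ _
  | hadd a b ha hb =>
    intro x hx
    rw [add_mul]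
    exact Submodule.add_mem _ (ha x hx) (hb x hx)
  | hmul a b ha hb =>
    intro x hx
    rw [mul_assoc]
    exact ha _ (hb x hx)

end Structure

/-! ### A graded representation of `𝒜(P)` -/

section Representation

variable (P : ℂ[X])

/-- The action of `e` on sequences of polynomials. -/
def opE : Module.End ℂ (ℤ → ℂ[X]) where
  toFun v := fun k => (v (k - 1)).comp (X - C 2)
  map_add' u v := by ext1 k; simp
  map_smul' c v := by ext1 k; simp

/-- The action of `f` on sequences of polynomials. -/
def opF : Module.End ℂ (ℤ → ℂ[X]) where
  toFun v := fun k => (v (k + 1)).comp (X + C 2) * P.comp (X + C 1)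
  map_add' u v := by ext1 k; simp [add_mul]
  map_smul' c v := by ext1 k; simp

/-- Multiplication of sequences of polynomials by a polynomial. -/
def opMul : ℂ[X] →ₐ[ℂ] Module.End ℂ (ℤ → ℂ[X]) := Algebra.lsmul ℂ ℂ (ℤ → ℂ[X])

lemma opE_apply (v : ℤ → ℂ[X]) (k : ℤ) : opE v k = (v (k - 1)).comp (X - C 2) := rfl

lemma opF_apply (v : ℤ → ℂ[X]) (k : ℤ) :
    opF P v k = (v (k + 1)).comp (X + C 2) * P.comp (X + C 1) := rfl

lemma opMul_apply (R : ℂ[X]) (v : ℤ → ℂ[X]) (k : ℤ) : opMul R v k = R * v k := rfl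

lemma aeval_opMul (R S : ℂ[X]) : aeval (opMul S) R = opMul (R.comp S) := by
  rw [aeval_algHom_apply]
  rfl

/-- The representation of `𝒜(P)` on sequences of polynomials. -/
def gradedRep : AP P →ₐ[ℂ] Module.End ℂ (ℤ → ℂ[X]) :=
  RingQuot.liftAlgHom ℂ ⟨FreeAlgebra.lift ℂ ![opE, opF P, opMul X], by
    have hE : FreeAlgebra.lift ℂ ![opE, opF P, opMul X] Egen = opE := by simp [Egen]
    have hF : FreeAlgebra.lift ℂ ![opE, opF P, opMul X] Fgen = opF P := by simp [Fgen]
    have hH : FreeAlgebra.lift ℂ ![opE, opF P, opMul X] Hgen = opMul X := by simp [Hgen]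
    have h1 : (1 : Module.End ℂ (ℤ → ℂ[X])) = opMul (C 1) := by simp
    have h2 : (2 : Module.End ℂ (ℤ → ℂ[X])) = opMul (C 2) := by
      rw [show (C 2 : ℂ[X]) = 2 from rfl, map_ofNat]
    rintro x y (_ | _ | _ | _)
    · simp only [map_sub, map_mul, map_ofNat, hE, hH]
      rw [h2]
      ext1 v; ext1 k
      simp only [LinearMap.sub_apply, Module.End.mul_apply, Pi.sub_apply, opE_apply, opMul_apply,
        mul_comp, X_comp]
      ring
    · simp only [map_sub, map_mul, map_ofNat, map_neg, hF, hH]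
      rw [h2]
      ext1 v; ext1 k
      simp only [LinearMap.sub_apply, LinearMap.neg_apply, Module.End.mul_apply, Pi.sub_apply,
        Pi.neg_apply, opF_apply, opMul_apply, mul_comp, X_comp]
      ring
    · rw [map_mul, ← aeval_algHom_apply, map_sub, map_one, hE, hF, hH, h1, ← map_sub, aeval_opMul]
      ext1 v; ext1 k
      simp only [Module.End.mul_apply, opE_apply, opF_apply, opMul_apply, mul_comp, comp_assoc,
        add_comp, X_comp, C_comp, sub_add_cancel, comp_X]
      rw [show (X - C 2 + C 1 : ℂ[X]) = X - C 1 by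
        rw [show (C 2 : ℂ[X]) = C 1 + C 1 by rw [← C_add]; norm_num]; ring]
      ring
    · rw [map_mul, ← aeval_algHom_apply, map_add, map_one, hE, hF, hH, h1, ← map_add, aeval_opMul]
      ext1 v; ext1 k
      simp only [Module.End.mul_apply, opE_apply, opF_apply, opMul_apply, comp_assoc,
        sub_comp, X_comp, C_comp, add_sub_cancel_right, comp_X]
      ring⟩

lemma gradedRep_eA : gradedRep P (eA P) = opE := by
  simp [gradedRep, eA, Egen]

lemma gradedRep_fA : gradedRep P (fA P) = opF P := by
  simp [gradedRep, fA, Fgen]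

lemma gradedRep_polyH (R : ℂ[X]) : gradedRep P (polyH P R) = opMul R := by
  have h : gradedRep P (hA P) = opMul X := by simp [gradedRep, hA, Hgen]
  rw [polyH, ← aeval_algHom_apply, h, aeval_opMul, comp_X]

/-- `a` acts homogeneously of degree `d` in the graded representation. -/
def HasDegree (d : ℤ) (a : AP P) : Prop :=
  ∀ (v : ℤ → ℂ[X]) (j : ℤ), (∀ i, i ≠ j → v i = 0) → ∀ i, i ≠ j + d → gradedRep P a v i = 0

variable {P}

lemma HasDegree.mul {d d' : ℤ} {a b : AP P} (ha : HasDegree P d a) (hb : HasDegree P d' b) :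
    HasDegree P (d + d') (a * b) := by
  intro v j hv i hi
  rw [map_mul, Module.End.mul_apply]
  exact ha _ (j + d') (hb v j hv) i (by omega)

lemma hasDegree_eA : HasDegree P 1 (eA P) := by
  intro v j hv i hi
  rw [gradedRep_eA, opE_apply, hv _ (by omega), zero_comp]

lemma hasDegree_fA : HasDegree P (-1) (fA P) := by
  intro v j hv i hi
  rw [gradedRep_fA, opF_apply, hv _ (by omega), zero_comp, zero_mul]

lemma hasDegree_polyH (R : ℂ[X]) : HasDegree P 0 (polyH P R) := by
  intro v j hv i hi
  rw [gradedRep_polyH, opMul_apply, hv _ (by omega), mul_zero]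

lemma HasDegree.pow {d : ℤ} {a : AP P} (ha : HasDegree P d a) (n : ℕ) :
    HasDegree P (n * d) (a ^ n) := by
  induction n with
  | zero => simpa using hasDegree_polyH (P := P) 1
  | succ n ih =>
    have := ih.mul ha
    rw [← pow_succ] at this
    convert this using 1
    push_cast; ring

lemma HasDegree.neg {d : ℤ} {a : AP P} (ha : HasDegree P d a) : HasDegree P d (-a) := by
  intro v j hv i hi
  rw [map_neg, LinearMap.neg_apply, Pi.neg_apply, ha v j hv i hi, neg_zero]

lemma hasDegree_gradedGen (k : ℤ) : HasDegree P k (gradedGen P k) := by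
  obtain ⟨n, rfl | rfl⟩ := k.eq_nat_or_neg
  · rw [gradedGen_natCast]
    simpa using (hasDegree_eA (P := P)).pow n
  · rw [gradedGen_neg_natCast]
    simpa using (hasDegree_fA (P := P)).pow n

variable (P)

/-- The extension by zero to `𝒜(P)` of a linear functional on the polynomials in `h`. -/
def extendTrace (T : ℂ[X] →ₗ[ℂ] ℂ) : AP P →ₗ[ℂ] ℂ :=
  T.comp ((LinearMap.proj 0).comp
    ((LinearMap.applyₗ (Pi.single 0 1 : ℤ → ℂ[X])).comp (gradedRep P).toLinearMap))

lemma extendTrace_apply (T : ℂ[X] →ₗ[ℂ] ℂ) (a : AP P) :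
    extendTrace P T a = T (gradedRep P a (Pi.single 0 1) 0) := rfl

lemma extendTrace_polyH (T : ℂ[X] →ₗ[ℂ] ℂ) (R : ℂ[X]) : extendTrace P T (polyH P R) = T R := by
  simp [extendTrace_apply, gradedRep_polyH, opMul_apply]

variable {P}

lemma HasDegree.extendTrace_eq_zero {d : ℤ} {a : AP P} (ha : HasDegree P d a) (hd : d ≠ 0)
    (T : ℂ[X] →ₗ[ℂ] ℂ) : extendTrace P T a = 0 := by
  rw [extendTrace_apply, ha _ 0 (fun i hi => Pi.single_eq_of_ne hi _) 0 (by omega), map_zero]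

end Representation

/-! ### The antilinear involution of `𝒜(P)` -/

section Involution

/-! The subtraction and negation of `AP P` are not reducibly those of its ring structure, so the
general sign rules are restated for rewriting. -/

lemma AP.neg_mul {P : ℂ[X]} (a b : AP P) : -a * b = -(a * b) := _root_.neg_mul a b

lemma AP.mul_neg {P : ℂ[X]} (a b : AP P) : a * -b = -(a * b) := _root_.mul_neg a b

lemma AP.neg_mul_neg {P : ℂ[X]} (a b : AP P) : -a * -b = a * b := _root_.neg_mul_neg a b

lemma AP.neg_pow_of_even {P : ℂ[X]} (a : AP P) {n : ℕ} (hn : Even n) : (-a) ^ n = a ^ n :=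
  hn.neg_pow a

lemma AP.neg_pow_of_odd {P : ℂ[X]} (a : AP P) {n : ℕ} (hn : Odd n) : (-a) ^ n = -a ^ n :=
  hn.neg_pow a

/-- The algebra `𝒜(P)` with the conjugate scalar action. -/
def ConjAP (P : ℂ[X]) : Type := AP P

instance (P : ℂ[X]) : Ring (ConjAP P) := inferInstanceAs (Ring (AP P))

instance (P : ℂ[X]) : Algebra ℂ (ConjAP P) :=
  RingHom.toAlgebra' ((algebraMap ℂ (AP P)).comp (starRingEnd ℂ))
    fun c x => Algebra.commutes (starRingEnd ℂ c) (show AP P from x)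

variable {P : ℂ[X]}

/-- The identity map to the conjugate algebra. -/
def toConj (P : ℂ[X]) : AP P ≃+* ConjAP P := RingEquiv.refl (AP P)

lemma aeval_toConj (a : AP P) (R : ℂ[X]) :
    aeval (toConj P a) R = toConj P (aeval a (R.map (starRingEnd ℂ))) := by
  rw [aeval_def, aeval_def, eval₂_map]
  exact (hom_eval₂ R ((algebraMap ℂ (AP P)).comp (starRingEnd ℂ)) (toConj P : AP P →+* ConjAP P)
    a).symm

/-- The antilinear automorphism of `𝒜(P)` with `e ↦ -f`, `f ↦ -e`, `h ↦ -h`. -/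
def starHomAux (hP : pstar P = P) : AP P →ₐ[ℂ] ConjAP P :=
  RingQuot.liftAlgHom ℂ ⟨FreeAlgebra.lift ℂ
    ![toConj P (-fA P), toConj P (-eA P), toConj P (-hA P)], by
    set φ := FreeAlgebra.lift ℂ ![toConj P (-fA P), toConj P (-eA P), toConj P (-hA P)] with hφ
    have hE : φ Egen = toConj P (-fA P) := by rw [hφ, Egen, FreeAlgebra.lift_ι_apply]; rfl
    have hF : φ Fgen = toConj P (-eA P) := by rw [hφ, Fgen, FreeAlgebra.lift_ι_apply]; rfl
    have hH : φ Hgen = toConj P (-hA P) := by rw [hφ, Hgen, FreeAlgebra.lift_ι_apply]; rfl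
    have h1 : (1 : ConjAP P) = toConj P 1 := (map_one _).symm
    have h2 : (2 : ConjAP P) = toConj P 2 := (map_ofNat _ 2).symm
    have hP' : P.map (starRingEnd ℂ) = P.comp (-X) := by
      conv_rhs => rw [← hP, pstar_apply, comp_assoc]
      simp
    rintro x y (_ | _ | _ | _)
    · rw [map_sub, map_mul, map_mul, map_mul, map_ofNat, hE, hH, h2, ← map_mul, ← map_mul,
        ← map_mul, ← map_sub]
      congr 1
      rw [AP.neg_mul_neg, AP.neg_mul_neg, hA_mul_fA]
      rw [AP.mul_neg, mul_sub, mul_two, two_mul]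
      abel
    · rw [map_sub, map_neg, map_mul, map_mul, map_mul, map_ofNat, hF, hH, h2, ← map_mul,
        ← map_mul, ← map_mul, ← map_sub, ← map_neg]
      congr 1
      rw [AP.neg_mul_neg, AP.neg_mul_neg, hA_mul_eA]
      noncomm_ring
    · rw [map_mul, ← aeval_algHom_apply, map_sub, map_one, hE, hF, hH, h1, ← map_sub, ← map_mul,
        aeval_toConj]
      congr 1
      rw [AP.neg_mul_neg, fA_mul_eA, hP', polyH, aeval_comp, aeval_comp]
      simp [add_comm]
    · rw [map_mul, ← aeval_algHom_apply, map_add, map_one, hE, hF, hH, h1, ← map_add, ← map_mul,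
        aeval_toConj]
      congr 1
      rw [AP.neg_mul_neg, eA_mul_fA, hP', polyH, aeval_comp, aeval_comp]
      simp [sub_eq_add_neg, add_comm]⟩

/-- The antilinear automorphism of `𝒜(P)` with `e ↦ -f`, `f ↦ -e`, `h ↦ -h`, as a ring
homomorphism. -/
def starHom (hP : pstar P = P) : AP P →+* AP P :=
  ((toConj P).symm : ConjAP P →+* AP P).comp (starHomAux hP : AP P →+* ConjAP P)

variable (hP : pstar P = P)

lemma starHom_mkAlgHom (x : FA) :
    starHom hP (RingQuot.mkAlgHom ℂ (ARel P) x) = (toConj P).symm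
      (FreeAlgebra.lift ℂ ![toConj P (-fA P), toConj P (-eA P), toConj P (-hA P)] x) :=
  congrArg (toConj P).symm (RingQuot.liftAlgHom_mkAlgHom_apply ℂ _ _ x)

lemma starHom_eA : starHom hP (eA P) = -fA P := by
  rw [eA, starHom_mkAlgHom, Egen, FreeAlgebra.lift_ι_apply]
  rfl

lemma starHom_fA : starHom hP (fA P) = -eA P := by
  rw [fA, starHom_mkAlgHom, Fgen, FreeAlgebra.lift_ι_apply]
  rfl

lemma starHom_hA : starHom hP (hA P) = -hA P := by
  rw [hA, starHom_mkAlgHom, Hgen, FreeAlgebra.lift_ι_apply]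
  rfl

lemma starHom_algebraMap (c : ℂ) :
    starHom hP (algebraMap ℂ (AP P) c) = algebraMap ℂ (AP P) (starRingEnd ℂ c) :=
  (starHomAux hP).commutes c

lemma starHom_polyH (R : ℂ[X]) : starHom hP (polyH P R) = polyH P (pstar R) := by
  induction R using Polynomial.induction_on' with
  | add p q hp hq => simp only [map_add, hp, hq]
  | monomial n a =>
    rw [← C_mul_X_pow_eq_monomial]
    simp only [map_mul, map_pow, polyH_X, starHom_hA, pstar_C, pstar_X, map_neg]
    have h : ∀ c, polyH P (C c) = algebraMap ℂ (AP P) c := fun c => by simp [polyH]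
    rw [h, h, starHom_algebraMap]

lemma starHom_starHom (a : AP P) : starHom hP (starHom hP a) = a := by
  induction a using AP.induction with
  | hsc c => simp [starHom_algebraMap]
  | he => simp [starHom_eA, starHom_fA]
  | hf => simp [starHom_eA, starHom_fA]
  | hh => simp [starHom_hA]
  | hadd a b ha hb => rw [map_add, map_add, ha, hb]
  | hmul a b ha hb => rw [map_mul, map_mul, ha, hb]

lemma hasDegree_starHom_gradedGen (k : ℤ) : HasDegree P (-k) (starHom hP (gradedGen P k)) := by
  obtain ⟨n, rfl | rfl⟩ := k.eq_nat_or_neg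
  · rw [gradedGen_natCast, map_pow, starHom_eA]
    simpa using (hasDegree_fA (P := P)).neg.pow n
  · rw [gradedGen_neg_natCast, map_pow, starHom_fA]
    simpa using (hasDegree_eA (P := P)).neg.pow n

end Involution

/-! ### From positive traces to invariant forms -/

/-- A linear functional on `ℂ[x]` inducing a trace on `𝒜(P)` whose associated invariant form is
Hermitian and positive definite. -/
structure IsPositiveTrace (P : ℂ[X]) (T : ℂ[X] →ₗ[ℂ] ℂ) : Prop where
  shift : ∀ S : ℂ[X], T ((S * P).comp (X - C 1)) = T ((S * P).comp (X + C 1))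
  herm : ∀ R, T (pstar R) = starRingEnd ℂ (T R)
  pos_even : ∀ R ≠ 0, ∃ r : ℝ, 0 < r ∧ T (R * pstar R) = r
  pos_odd : ∀ R ≠ 0, ∃ r : ℝ, 0 < r ∧ -T ((R * pstar R * P).comp (X - C 1)) = r

namespace IsPositiveTrace

variable {P : ℂ[X]} {T : ℂ[X] →ₗ[ℂ] ℂ}

lemma trace_eA_mul (hT : IsPositiveTrace P T) (b : AP P) :
    extendTrace P T (eA P * b) = extendTrace P T (b * eA P) := by
  obtain ⟨c, rfl⟩ := exists_finsupp_eq P b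
  simp only [Finsupp.sum, Finset.mul_sum, Finset.sum_mul, map_sum]
  refine Finset.sum_congr rfl fun k _ => ?_
  have hd := (hasDegree_polyH (P := P) (c k)).mul (hasDegree_gradedGen k)
  by_cases hk : k = -1
  · subst hk
    have hg : gradedGen P (-1) = fA P := by simpa using gradedGen_neg_natCast P 1
    rw [hg, ← mul_assoc, eA_polyH_fA, mul_assoc, fA_mul_eA, ← map_mul, extendTrace_polyH,
      extendTrace_polyH]
    have h := hT.shift ((c (-1)).comp (X - C 1))
    have h2 : (X - C 1 - C 1 : ℂ[X]) = X - C 2 := by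
      rw [sub_sub, ← C_add]; norm_num
    simpa only [mul_comp, comp_assoc, sub_comp, X_comp, C_comp, h2, add_sub_cancel_right,
      comp_X] using h
  · rw [(hasDegree_eA.mul hd).extendTrace_eq_zero (by omega),
      (hd.mul hasDegree_eA).extendTrace_eq_zero (by omega)]

lemma trace_fA_mul (hT : IsPositiveTrace P T) (b : AP P) :
    extendTrace P T (fA P * b) = extendTrace P T (b * fA P) := by
  obtain ⟨c, rfl⟩ := exists_finsupp_eq P b
  simp only [Finsupp.sum, Finset.mul_sum, Finset.sum_mul, map_sum]
  refine Finset.sum_congr rfl fun k _ => ?_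
  have hd := (hasDegree_polyH (P := P) (c k)).mul (hasDegree_gradedGen k)
  by_cases hk : k = 1
  · subst hk
    have hg : gradedGen P 1 = eA P := by simpa using gradedGen_natCast P 1
    rw [hg, ← mul_assoc, fA_polyH_eA, mul_assoc, eA_mul_fA, ← map_mul, extendTrace_polyH,
      extendTrace_polyH]
    have h := hT.shift ((c 1).comp (X + C 1))
    have h2 : (X + C 1 + C 1 : ℂ[X]) = X + C 2 := by
      rw [add_assoc, ← C_add]; norm_num
    simpa only [mul_comp, comp_assoc, add_comp, X_comp, C_comp, h2, sub_add_cancel,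
      comp_X] using h.symm
  · rw [(hasDegree_fA.mul hd).extendTrace_eq_zero (by omega),
      (hd.mul hasDegree_fA).extendTrace_eq_zero (by omega)]

lemma trace_hA_mul (b : AP P) :
    extendTrace P T (hA P * b) = extendTrace P T (b * hA P) := by
  obtain ⟨c, rfl⟩ := exists_finsupp_eq P b
  simp only [Finsupp.sum, Finset.mul_sum, Finset.sum_mul, map_sum]
  refine Finset.sum_congr rfl fun k _ => ?_
  have hd := (hasDegree_polyH (P := P) (c k)).mul (hasDegree_gradedGen k)
  have hh := hasDegree_polyH (P := P) X
  rw [← polyH_X]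
  by_cases hk : k = 0
  · subst hk
    have hg : gradedGen P 0 = 1 := by simpa using gradedGen_natCast P 0
    rw [hg, mul_one, ← map_mul, ← map_mul, mul_comm]
  · rw [(hh.mul hd).extendTrace_eq_zero (by omega), (hd.mul hh).extendTrace_eq_zero (by omega)]

/-- The extension of a positive trace to `𝒜(P)` is a trace. -/
lemma trace_mul_comm (hT : IsPositiveTrace P T) (a b : AP P) :
    extendTrace P T (a * b) = extendTrace P T (b * a) := by
  induction a using AP.induction generalizing b with
  | hsc c => rw [Algebra.commutes]
  | he => exact hT.trace_eA_mul b
  | hf => exact hT.trace_fA_mul b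
  | hh => exact trace_hA_mul b
  | hadd x y hx hy => rw [add_mul, mul_add, map_add, map_add, hx, hy]
  | hmul x y hx hy => rw [mul_assoc, hx, mul_assoc, hy, mul_assoc]

lemma trace_starHom (hT : IsPositiveTrace P T) (hP : pstar P = P) (a : AP P) :
    extendTrace P T (starHom hP a) = starRingEnd ℂ (extendTrace P T a) := by
  obtain ⟨c, rfl⟩ := exists_finsupp_eq P a
  simp only [Finsupp.sum, map_sum, map_mul]
  refine Finset.sum_congr rfl fun k _ => ?_
  rw [starHom_polyH]
  by_cases hk : k = 0
  · subst hk
    have hg : gradedGen P 0 = 1 := by simpa using gradedGen_natCast P 0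
    rw [hg, map_one, mul_one, mul_one, extendTrace_polyH, extendTrace_polyH, hT.herm]
  · rw [((hasDegree_polyH _).mul (hasDegree_starHom_gradedGen hP k)).extendTrace_eq_zero
        (by omega), ((hasDegree_polyH _).mul (hasDegree_gradedGen k)).extendTrace_eq_zero
        (by omega), map_zero]

/-- The Hermitian invariant form attached to a positive trace. -/
def invForm (hT : IsPositiveTrace P T) (hP : pstar P = P) : InvForm P where
  B u v := extendTrace P T (u * starHom hP v)
  add_left u v w := by rw [add_mul, map_add]
  smul_left c u v := by rw [smul_mul_assoc, map_smul, smul_eq_mul]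
  conj_symm u v := by
    rw [← hT.trace_starHom hP, map_mul (starHom hP), starHom_starHom, hT.trace_mul_comm]
  e_left u v := by
    rw [map_mul (starHom hP), starHom_fA, mul_assoc, hT.trace_eA_mul, AP.mul_neg, AP.mul_neg,
      map_neg, neg_neg, mul_assoc]
  h_left u v := by
    rw [map_mul (starHom hP), starHom_hA, mul_assoc, trace_hA_mul, AP.mul_neg, AP.mul_neg,
      map_neg, neg_neg, mul_assoc]
  f_left u v := by
    rw [map_mul (starHom hP), starHom_eA, mul_assoc, hT.trace_fA_mul, AP.mul_neg, AP.mul_neg,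
      map_neg, neg_neg, mul_assoc]
  e_right u v := by
    rw [map_mul (starHom hP), starHom_fA, AP.neg_mul, AP.mul_neg, map_neg, neg_neg, mul_assoc]
  h_right u v := by
    rw [map_mul (starHom hP), starHom_hA, AP.neg_mul, AP.mul_neg, map_neg, neg_neg, mul_assoc]
  f_right u v := by
    rw [map_mul (starHom hP), starHom_eA, AP.neg_mul, AP.mul_neg, map_neg, neg_neg, mul_assoc]

/-- Positivity of the trace form on `R(h) e ^ k`. -/
lemma trace_pow_pos (hT : IsPositiveTrace P T) (hP : pstar P = P) (hP0 : P ≠ 0) (k : ℕ) :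
    ∀ R : ℂ[X], R ≠ 0 → ∃ r : ℝ, 0 < r ∧ extendTrace P T
      ((-eA P) ^ k * polyH P R * fA P ^ k * polyH P (pstar R)) = r := by
  have hcomp : ∀ (c : ℂ) {R : ℂ[X]}, R ≠ 0 → R.comp (X + C c) ≠ 0 := fun c R hR h =>
    hR ((comp_eq_zero_iff.1 h).resolve_right fun h' => by
      have := congrArg (fun q => coeff q 1) h'.2
      simp at this)
  have hcomp' : ∀ (c : ℂ) {R : ℂ[X]}, R ≠ 0 → R.comp (X - C c) ≠ 0 := fun c R hR => by
    simpa [sub_eq_add_neg] using hcomp (-c) hR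
  induction k using Nat.twoStepInduction with
  | zero =>
    intro R hR
    simpa [← map_mul, extendTrace_polyH] using hT.pos_even R hR
  | one =>
    intro R hR
    obtain ⟨r, hr, h⟩ := hT.pos_odd _ (hcomp' 1 hR)
    refine ⟨r, hr, ?_⟩
    rw [← h, pow_one, pow_one, AP.neg_mul, AP.neg_mul, AP.neg_mul, map_neg, eA_polyH_fA, ← map_mul,
      extendTrace_polyH, pstar_comp]
    have h2 : (X - C 1 - C 1 : ℂ[X]) = X - C 2 := by
      rw [sub_sub, ← C_add]; norm_num
    congr 2
    simp only [mul_comp, comp_assoc, sub_comp, X_comp, h2, map_sub, pstar_X, neg_comp, C_comp,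
      pstar_C, map_one (starRingEnd ℂ)]
    rw [show (-(X - C 1) - C 1 : ℂ[X]) = -X by ring, neg_neg, comp_X]
    ring
  | more k ih _ =>
    intro R hR
    obtain ⟨r, hr, h⟩ := ih (R.comp (X - C 2) * P.comp (X - C 1))
      (mul_ne_zero (hcomp' 2 hR) (hcomp' 1 hP0))
    refine ⟨r, hr, ?_⟩
    rw [← h]
    have h1 : (-eA P) ^ (k + 2) * polyH P R * fA P ^ (k + 2) * polyH P (pstar R) =
        eA P * ((-eA P) ^ k * (eA P * polyH P R * fA P) * fA P ^ k *
          (fA P * polyH P (pstar R))) := by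
      have he : (-eA P) ^ (k + 2) = eA P * (-eA P) ^ k * eA P := by
        rw [pow_succ, pow_succ', AP.neg_mul, AP.neg_mul_neg]
      have hf : fA P ^ (k + 2) = fA P * fA P ^ k * fA P := by rw [pow_succ, pow_succ']
      rw [he, hf]
      simp only [mul_assoc]
    rw [h1, hT.trace_eA_mul, mul_assoc, fA_polyH_eA, eA_polyH_fA]
    congr 4
    rw [map_mul, pstar_comp, pstar_comp, hP]
    simp only [map_sub, pstar_X, map_one, map_ofNat]
    congr 2 <;> ring

theorem unitarizable (hT : IsPositiveTrace P T) (hP : pstar P = P) (hP0 : P ≠ 0) :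
    Unitarizable P := by
  refine ⟨hT.invForm hP, fun u hu => ?_⟩
  obtain ⟨c, rfl⟩ := exists_finsupp_eq P u
  have hdiag : ∀ k ∈ c.support, ∃ r : ℝ, 0 < r ∧ extendTrace P T
      (polyH P (c k) * gradedGen P k * starHom hP (polyH P (c k) * gradedGen P k)) = r := by
    intro k hk
    have hck : c k ≠ 0 := by simpa using hk
    rw [map_mul (starHom hP), starHom_polyH]
    obtain ⟨n, rfl | rfl⟩ := k.eq_nat_or_neg
    · have hck' : pstar (c n) ≠ 0 := fun h => hck (by rw [← pstar_pstar (c n), h, map_zero])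
      obtain ⟨r, hr, h⟩ := hT.trace_pow_pos hP hP0 n _ hck'
      refine ⟨r, hr, ?_⟩
      have hsign : eA P ^ n * polyH P (pstar (c n)) * (-fA P) ^ n =
          (-eA P) ^ n * polyH P (pstar (c n)) * fA P ^ n := by
        rcases n.even_or_odd with hn | hn
        · rw [AP.neg_pow_of_even _ hn, AP.neg_pow_of_even _ hn]
        · rw [AP.neg_pow_of_odd _ hn, AP.neg_pow_of_odd _ hn, AP.mul_neg, AP.neg_mul, AP.neg_mul]
      rw [← h, gradedGen_natCast, map_pow, starHom_eA, pstar_pstar, ← hsign,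
        hT.trace_mul_comm _ (polyH P (c n))]
      simp only [mul_assoc]
    · obtain ⟨r, hr, h⟩ := hT.trace_pow_pos hP hP0 n _ hck
      refine ⟨r, hr, ?_⟩
      rw [← h, gradedGen_neg_natCast, map_pow, starHom_fA, ← mul_assoc,
        hT.trace_mul_comm _ ((-eA P) ^ n)]
      simp only [mul_assoc]
  choose! r hr hrT using hdiag
  refine ⟨∑ k ∈ c.support, r k, Finset.sum_pos hr ?_, ?_⟩
  · rw [Finsupp.support_nonempty_iff]
    rintro rfl
    exact hu Finsupp.sum_zero_index
  · change extendTrace P T (_ * _) = _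
    simp only [Finsupp.sum, map_sum, Finset.sum_mul_sum]
    rw [Complex.ofReal_sum]
    refine Finset.sum_congr rfl fun k hk => ?_
    rw [Finset.sum_eq_single k, hrT k hk]
    · intro l _ hlk
      rw [map_mul (starHom hP), starHom_polyH]
      exact (((hasDegree_polyH _).mul (hasDegree_gradedGen k)).mul ((hasDegree_polyH _).mul
        (hasDegree_starHom_gradedGen hP l))).extendTrace_eq_zero (by omega) T
    · exact fun h => absurd hk h

end IsPositiveTrace

/-! ### Functions of exponential decay in a horizontal strip -/

section Strip

open Complex MeasureTheory Filter Topology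

/-- On the strip `|Im z| ≤ 1`, the function `f` decays like `exp (-σ |Re z|)` up to a
subexponential factor. -/
def ExpDecay (σ : ℝ) (f : ℂ → ℂ) : Prop :=
  ∀ δ > 0, ∃ C, ∀ z : ℂ, |z.im| ≤ 1 → ‖f z‖ ≤ C * Real.exp ((δ - σ) * |z.re|)

namespace ExpDecay

variable {σ τ : ℝ} {f g : ℂ → ℂ}

lemma of_bound {C : ℝ} (h : ∀ z : ℂ, |z.im| ≤ 1 → ‖f z‖ ≤ C * Real.exp (-σ * |z.re|)) :
    ExpDecay σ f := by
  intro δ hδ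
  have hC : 0 ≤ C := by simpa using (norm_nonneg _).trans (h 0 (by simp))
  refine ⟨C, fun z hz => (h z hz).trans ?_⟩
  gcongr
  linarith

protected lemma mul (hf : ExpDecay σ f) (hg : ExpDecay τ g) :
    ExpDecay (σ + τ) (fun z => f z * g z) := by
  intro δ hδ
  obtain ⟨C, hC⟩ := hf (δ / 2) (half_pos hδ)
  obtain ⟨D, hD⟩ := hg (δ / 2) (half_pos hδ)
  refine ⟨C * D, fun z hz => ?_⟩
  rw [norm_mul, show (δ - (σ + τ)) * |z.re| = (δ / 2 - σ) * |z.re| + (δ / 2 - τ) * |z.re| by ring,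
    Real.exp_add, mul_mul_mul_comm]
  exact mul_le_mul (hC z hz) (hD z hz) (norm_nonneg _) ((norm_nonneg _).trans (hC z hz))

protected lemma add (hf : ExpDecay σ f) (hg : ExpDecay σ g) :
    ExpDecay σ (fun z => f z + g z) := by
  intro δ hδ
  obtain ⟨C, hC⟩ := hf δ hδ
  obtain ⟨D, hD⟩ := hg δ hδ
  refine ⟨C + D, fun z hz => (norm_add_le _ _).trans ?_⟩
  rw [add_mul]
  exact add_le_add (hC z hz) (hD z hz)

lemma const (c : ℂ) : ExpDecay 0 (fun _ => c) :=
  of_bound (C := ‖c‖) fun z _ => by simp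

lemma id : ExpDecay 0 (fun z => z) := by
  intro δ hδ
  refine ⟨1 / δ + 1, fun z hz => ?_⟩
  have h1 := Real.add_one_le_exp (δ * |z.re|)
  have h2 : |z.re| ≤ 1 / δ * Real.exp (δ * |z.re|) := by
    rw [one_div, ← div_eq_inv_mul, le_div_iff₀ hδ]
    linarith
  have h3 : 1 ≤ Real.exp (δ * |z.re|) := Real.one_le_exp (by positivity)
  rw [sub_zero]
  linarith [norm_le_abs_re_add_abs_im z]

lemma eval (p : ℂ[X]) : ExpDecay 0 (fun z => p.eval z) := by
  induction p using Polynomial.induction_on with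
  | C a => simpa using const a
  | add p q hp hq => simpa using hp.add hq
  | monomial n a ih => simpa [pow_succ, mul_assoc] using ih.mul id

end ExpDecay

lemma integrable_exp_neg_mul_abs {ε : ℝ} (hε : 0 < ε) :
    Integrable fun t : ℝ => Real.exp (-ε * |t|) := by
  rw [← integrableOn_univ, ← Set.Iic_union_Ioi (a := (0 : ℝ)), integrableOn_union]
  constructor
  · refine (integrableOn_exp_mul_Iic hε 0).congr_fun (fun t ht => ?_) measurableSet_Iic
    simp [abs_of_nonpos (Set.mem_Iic.1 ht)]
  · refine (integrableOn_exp_mul_Ioi (neg_lt_zero.2 hε) 0).congr_fun (fun t ht => ?_)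
      measurableSet_Ioi
    simp [abs_of_pos (Set.mem_Ioi.1 ht)]

namespace ExpDecay

variable {σ : ℝ} {f : ℂ → ℂ}

lemma integrable (hf : ExpDecay σ f) (hσ : 0 < σ) {y : ℝ} (hy : |y| ≤ 1)
    (hc : Continuous fun t : ℝ => f (t + y * I)) : Integrable fun t : ℝ => f (t + y * I) := by
  obtain ⟨C, hC⟩ := hf (σ / 2) (half_pos hσ)
  refine ((integrable_exp_neg_mul_abs (half_pos hσ)).const_mul C).mono' hc.aestronglyMeasurable
    (Eventually.of_forall fun t => ?_)
  have := hC (t + y * I) (by simpa using hy)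
  rw [show σ / 2 - σ = -(σ / 2) by ring] at this
  simpa using this

/-- Contour shift inside the strip. -/
theorem integral_add_mul_I (hf : ExpDecay σ f) (hσ : 0 < σ)
    (hd : ∀ z : ℂ, |z.im| ≤ 1 → DifferentiableAt ℂ f z) {y : ℝ} (hy : |y| ≤ 1) :
    ∫ t : ℝ, f (t + y * I) = ∫ t : ℝ, f t := by
  have hc : ∀ y : ℝ, |y| ≤ 1 → Continuous fun t : ℝ => f (t + y * I) := fun y hy =>
    continuous_iff_continuousAt.2 fun t => by
      have : ContinuousAt f (t + y * I) := (hd _ (by simpa using hy)).continuousAt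
      exact ContinuousAt.comp (f := fun t : ℝ => (t + y * I : ℂ)) this (by fun_prop)
  have hlim : ∀ y : ℝ, |y| ≤ 1 → Tendsto (fun R : ℝ => ∫ t in (-R)..R, f (t + y * I)) atTop
      (𝓝 (∫ t : ℝ, f (t + y * I))) := fun y hy =>
    intervalIntegral_tendsto_integral (hf.integrable hσ hy (hc y hy)) tendsto_neg_atTop_atBot
      tendsto_id
  have him : ∀ s ∈ Set.uIcc 0 y, |s| ≤ 1 := fun s hs => by
    rw [Set.mem_uIcc] at hs
    rw [abs_le] at hy ⊢
    constructor <;> rcases hs with hs | hs <;> linarith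
  obtain ⟨C, hC⟩ := hf (σ / 2) (half_pos hσ)
  have hexp : Tendsto (fun R : ℝ => C * Real.exp (-(σ / 2) * |R|) * |y|) atTop (𝓝 0) := by
    have h1 : Tendsto (fun R : ℝ => -(σ / 2) * |R|) atTop atBot :=
      tendsto_abs_atTop_atTop.const_mul_atTop_of_neg (by linarith)
    simpa using ((Real.tendsto_exp_atBot.comp h1).const_mul C).mul_const |y|
  have hside : ∀ x : ℝ, ‖∫ s in (0 : ℝ)..y, f (x + s * I)‖ ≤
      C * Real.exp (-(σ / 2) * |x|) * |y| := fun x => by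
    have h := intervalIntegral.norm_integral_le_of_norm_le_const (a := 0) (b := y)
      (f := fun s : ℝ => f (x + s * I)) (C := C * Real.exp (-(σ / 2) * |x|)) fun s hs => by
        have := hC (x + s * I) (by simpa using him s (Set.uIoc_subset_uIcc hs))
        rw [show σ / 2 - σ = -(σ / 2) by ring] at this
        simpa using this
    simpa using h
  have hright : Tendsto (fun R : ℝ => ∫ s in (0 : ℝ)..y, f (R + s * I)) atTop (𝓝 0) :=
    squeeze_zero_norm hside hexp
  have hleft : Tendsto (fun R : ℝ => ∫ s in (0 : ℝ)..y, f ((-R : ℝ) + s * I)) atTop (𝓝 0) :=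
    squeeze_zero_norm (fun R => by simpa using hside (-R)) hexp
  have hrect : ∀ R : ℝ, (∫ t in (-R)..R, f (t + (0 : ℝ) * I)) - (∫ t in (-R)..R, f (t + y * I)) +
      I * (∫ s in (0 : ℝ)..y, f (R + s * I)) - I * (∫ s in (0 : ℝ)..y, f ((-R : ℝ) + s * I)) = 0 :=
    fun R => by
      have h := integral_boundary_rect_eq_zero_of_differentiableOn f ((-R : ℝ) : ℂ) (R + y * I)
        fun z hz => (hd z (him _ (by simpa using hz.2))).differentiableWithinAt
      simpa using h
  have h0 := (((hlim 0 (by simp)).sub (hlim y hy)).add (hright.const_mul I)).sub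
    (hleft.const_mul I)
  simp only [hrect] at h0
  have h := tendsto_nhds_unique h0 tendsto_const_nhds
  simp only [mul_zero, add_zero, sub_zero, ofReal_zero, zero_mul] at h
  exact (sub_eq_zero.1 h).symm

end ExpDecay

/-! ### Traces from shift kernels -/

/-- The data `(Φ, κ)` realising a positive trace: `Φ` is holomorphic in the closed strip
`|Im z| ≤ 1`, positive on the real line, and equals `s p κ` on the boundary of the strip, where
`κ` is a positive function of the real part; both decay with rate `σ`. -/
structure IsShiftKernel (p : ℂ[X]) (s σ : ℝ) (Φ : ℂ → ℂ) (κ : ℝ → ℝ) : Prop where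
  differentiableAt : ∀ z : ℂ, |z.im| ≤ 1 → DifferentiableAt ℂ Φ z
  pos : ∀ t : ℝ, ∃ r : ℝ, 0 < r ∧ Φ t = r
  continuous : Continuous κ
  pos_weight : ∀ t, 0 < κ t
  add_I : ∀ t : ℝ, Φ (t + I) = s * p.eval (t + I) * κ t
  sub_I : ∀ t : ℝ, Φ (t - I) = s * p.eval (t - I) * κ t
  expDecay : ExpDecay σ Φ
  expDecay_weight : ExpDecay σ fun z => κ z.re

lemma IsShiftKernel.mul {p q : ℂ[X]} {s s' σ σ' : ℝ} {Φ Φ' : ℂ → ℂ} {κ κ' : ℝ → ℝ}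
    (h : IsShiftKernel p s σ Φ κ) (h' : IsShiftKernel q s' σ' Φ' κ') :
    IsShiftKernel (p * q) (s * s') (σ + σ') (fun z => Φ z * Φ' z) (fun t => κ t * κ' t) where
  differentiableAt z hz := (h.differentiableAt z hz).mul (h'.differentiableAt z hz)
  pos t := by
    obtain ⟨r, hr, e⟩ := h.pos t
    obtain ⟨r', hr', e'⟩ := h'.pos t
    exact ⟨r * r', mul_pos hr hr', by simp [e, e']⟩
  continuous := h.continuous.mul h'.continuous
  pos_weight t := mul_pos (h.pos_weight t) (h'.pos_weight t)
  add_I t := by rw [h.add_I, h'.add_I, eval_mul]; push_cast; ring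
  sub_I t := by rw [h.sub_I, h'.sub_I, eval_mul]; push_cast; ring
  expDecay := h.expDecay.mul h'.expDecay
  expDecay_weight := by simpa using h.expDecay_weight.mul h'.expDecay_weight

lemma integral_polynomial_mul_pos {w : ℝ → ℝ} (hc : Continuous w) (hw : ∀ t, 0 < w t)
    {R : ℂ[X]} (hR : R ≠ 0) (hi : Integrable fun t : ℝ => ((‖R.eval (I * t)‖ ^ 2 * w t : ℝ) : ℂ)) :
    0 < ∫ t : ℝ, ‖R.eval (I * t)‖ ^ 2 * w t := by
  obtain ⟨t, ht⟩ : ∃ t : ℝ, R.eval (I * t) ≠ 0 := by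
    by_contra! h
    refine hR (Polynomial.eq_zero_of_infinite_isRoot R
      ((Set.infinite_range_of_injective (f := fun t : ℝ => I * (t : ℂ)) fun a b hab => ?_).mono ?_))
    · simpa using hab
    · rintro _ ⟨t, rfl⟩
      exact h t
  refine integral_pos_of_integrable_nonneg_nonzero (x := t) (by fun_prop) ?_ (fun t => ?_) ?_
  · simpa only [RCLike.re_eq_complex_re, ofReal_re] using hi.re
  · have := (hw t).le
    positivity
  · have := (hw t).ne'
    positivity

variable {P : ℂ[X]} {s σ : ℝ} {Φ : ℂ → ℂ} {κ : ℝ → ℝ}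

namespace IsShiftKernel

lemma integrable (h : IsShiftKernel (P.comp (C I * X)) s σ Φ κ) (hσ : 0 < σ) (R : ℂ[X]) :
    Integrable fun t : ℝ => R.eval (I * t) * κ t := by
  have hd := (ExpDecay.eval (R.comp (C I * X))).mul h.expDecay_weight
  have hκ := h.continuous
  have := hd.integrable (by simpa using hσ) (y := 0) (by simp) (by simp; fun_prop)
  simpa using this

/-- The functional `R ↦ ∫ R(it) κ(t) dt`. -/
def functional (h : IsShiftKernel (P.comp (C I * X)) s σ Φ κ) (hσ : 0 < σ) : ℂ[X] →ₗ[ℂ] ℂ where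
  toFun R := ∫ t : ℝ, R.eval (I * t) * κ t
  map_add' R S := by
    simp only [eval_add, add_mul]
    exact integral_add (h.integrable hσ R) (h.integrable hσ S)
  map_smul' c R := by
    simp only [eval_smul, smul_eq_mul, mul_assoc, RingHom.id_apply]
    exact integral_const_mul c _

variable (h : IsShiftKernel (P.comp (C I * X)) s σ Φ κ) (hσ : 0 < σ)

lemma functional_apply (R : ℂ[X]) : h.functional hσ R = ∫ t : ℝ, R.eval (I * t) * κ t := rfl

lemma contour (h : IsShiftKernel (P.comp (C I * X)) s σ Φ κ) (hσ : 0 < σ) (S : ℂ[X])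
    {y : ℝ} (hy : |y| ≤ 1) :
    ∫ t : ℝ, S.eval (I * (t + y * I)) * Φ (t + y * I) = ∫ t : ℝ, S.eval (I * t) * Φ t := by
  have hd := (ExpDecay.eval (S.comp (C I * X))).mul h.expDecay
  have := hd.integral_add_mul_I (by simpa using hσ)
    (fun z hz => (Polynomial.differentiableAt _).mul (h.differentiableAt z hz)) hy
  simpa using this

lemma functional_comp_sub (S : ℂ[X]) :
    s * h.functional hσ ((S * P).comp (X - C 1)) = ∫ t : ℝ, S.eval (I * t) * Φ t := by
  rw [← h.contour hσ S (y := 1) (by simp), functional_apply, ← integral_const_mul]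
  congr 1
  funext t
  have h1 : I * (t + (1 : ℝ) * I) = I * t - 1 := by
    rw [mul_add, mul_left_comm, I_mul_I]; push_cast; ring
  have h2 : (t + (1 : ℝ) * I : ℂ) = t + I := by simp
  rw [h1, h2, h.add_I]
  simp only [eval_comp, eval_mul, eval_sub, eval_X, eval_C]
  rw [← h2, h1]
  ring

lemma functional_comp_add (S : ℂ[X]) :
    s * h.functional hσ ((S * P).comp (X + C 1)) = ∫ t : ℝ, S.eval (I * t) * Φ t := by
  rw [← h.contour hσ S (y := -1) (by simp), functional_apply, ← integral_const_mul]
  congr 1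
  funext t
  have h1 : I * (t + (-1 : ℝ) * I) = I * t + 1 := by
    rw [mul_add, mul_left_comm, I_mul_I]; push_cast; ring
  have h2 : (t + (-1 : ℝ) * I : ℂ) = t - I := by push_cast; ring
  rw [h1, h2, h.sub_I]
  simp only [eval_comp, eval_mul, eval_add, eval_X, eval_C]
  rw [← h2, h1]
  ring

end IsShiftKernel

lemma eval_mul_pstar (R : ℂ[X]) (t : ℝ) :
    (R * pstar R).eval (I * t) = ((‖R.eval (I * t)‖ ^ 2 : ℝ) : ℂ) := by
  rw [eval_mul, eval_pstar]
  simp [mul_conj']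

theorem IsShiftKernel.isPositiveTrace (h : IsShiftKernel (P.comp (C I * X)) (-1) σ Φ κ)
    (hσ : 0 < σ) : IsPositiveTrace P (h.functional hσ) where
  shift S := by
    have h1 := (h.functional_comp_sub hσ S).trans (h.functional_comp_add hσ S).symm
    simpa using h1
  herm R := by
    rw [functional_apply, functional_apply, ← integral_conj]
    congr 1
    funext t
    simp [eval_pstar]
  pos_even R hR := by
    have hi := h.integrable hσ (R * pstar R)
    simp only [eval_mul_pstar, ← ofReal_mul] at hi
    refine ⟨_, integral_polynomial_mul_pos h.continuous h.pos_weight hR hi, ?_⟩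
    rw [functional_apply, ← integral_complex_ofReal]
    simp only [eval_mul_pstar, ← ofReal_mul]
  pos_odd R hR := by
    choose w hw hΦ using h.pos
    have hwc : Continuous w := by
      have : Continuous fun t : ℝ => Φ t := continuous_iff_continuousAt.2 fun t =>
        ContinuousAt.comp (f := fun t : ℝ => (t : ℂ))
          (h.differentiableAt t (by simp)).continuousAt (by fun_prop)
      simpa [hΦ, Function.comp_def] using continuous_re.comp this
    have hi : Integrable fun t : ℝ => (R * pstar R).eval (I * t) * w t := by
      have hd := (ExpDecay.eval ((R * pstar R).comp (C I * X))).mul h.expDecay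
      have := hd.integrable (by simpa using hσ) (y := 0) (by simp) (by simp [hΦ]; fun_prop)
      simpa [hΦ] using this
    simp only [eval_mul_pstar, ← ofReal_mul] at hi
    refine ⟨_, integral_polynomial_mul_pos hwc hw hR hi, ?_⟩
    have h1 := h.functional_comp_sub hσ (R * pstar R)
    rw [← integral_complex_ofReal]
    simpa only [hΦ, eval_mul_pstar, ofReal_neg, ofReal_one, neg_one_mul, ofReal_mul] using h1

end Strip

/-! ### Construction of shift kernels -/

section Kernels

open Complex Filter Topology

lemma ExpDecay.of_le {σ M : ℝ} {f g : ℂ → ℂ}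
    (hf : ∀ z : ℂ, |z.im| ≤ 1 → ContinuousAt f z) (hg : ExpDecay σ g)
    (h : ∀ z : ℂ, |z.im| ≤ 1 → M ≤ |z.re| → ‖f z‖ ≤ ‖g z‖) : ExpDecay σ f := by
  intro δ hδ
  obtain ⟨C, hC⟩ := hg δ hδ
  obtain ⟨D, hD⟩ := (isCompact_Icc.reProdIm isCompact_Icc :
    IsCompact (Set.Icc (-M) M ×ℂ Set.Icc (-1) 1)).exists_bound_of_continuousOn
    (f := fun z => f z * Real.exp (-((δ - σ) * |z.re|))) fun z hz =>
      ((hf z (abs_le.2 hz.2)).mul (by fun_prop)).continuousWithinAt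
  refine ⟨max C D, fun z hz => ?_⟩
  rcases le_total M |z.re| with hM | hM
  · refine ((h z hz hM).trans (hC z hz)).trans ?_
    gcongr
    exact le_max_left _ _
  · have := hD z ⟨abs_le.1 hM, abs_le.1 hz⟩
    rw [norm_mul, norm_real, Real.norm_of_nonneg (Real.exp_pos _).le, Real.exp_neg,
      ← div_eq_mul_inv, div_le_iff₀ (Real.exp_pos _)] at this
    refine this.trans ?_
    gcongr
    exact le_max_right _ _

/-- The sinh-quotient `z / sinh (π z / 2)`, extended to `z = 0`. -/
def invSinhc (z : ℂ) : ℂ := (dslope (fun w => sinh (Real.pi / 2 * w)) 0 z)⁻¹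

lemma sinh_half_pi_mul_ne_zero {z : ℂ} (hz : |z.im| < 2) (hz0 : z ≠ 0) :
    sinh (Real.pi / 2 * z) ≠ 0 := by
  intro h
  have h1 : sin (Real.pi / 2 * z * I) = 0 := by rw [sin_mul_I, h, zero_mul]
  obtain ⟨k, hk⟩ := sin_eq_zero_iff.1 h1
  have hpi : (Real.pi : ℂ) ≠ 0 := ofReal_ne_zero.2 Real.pi_ne_zero
  have h2 : z * I = 2 * k := mul_left_cancel₀ hpi (by linear_combination 2 * hk)
  have hre := congrArg re h2
  have him := congrArg im h2
  simp at hre him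
  have hk0 : k = 0 := by
    have h3 : |(2 * k : ℝ)| < 2 := by rw [← hre, abs_neg]; exact hz
    rw [abs_lt] at h3
    have h4 : (-1 : ℝ) < k := by linarith
    have h5 : (k : ℝ) < 1 := by linarith
    norm_cast at h4 h5
    omega
  refine hz0 (Complex.ext him ?_)
  simpa [hk0] using hre

lemma dslope_sinh_zero : dslope (fun w => sinh (Real.pi / 2 * w)) 0 0 = Real.pi / 2 := by
  rw [dslope_same]
  have h : HasDerivAt (fun w : ℂ => sinh (Real.pi / 2 * w)) (Real.pi / 2) 0 := by
    simpa using ((hasDerivAt_id' (0 : ℂ)).const_mul (Real.pi / 2 : ℂ)).csinh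
  exact h.deriv

lemma mul_dslope_sinh (z : ℂ) :
    z * dslope (fun w => sinh (Real.pi / 2 * w)) 0 z = sinh (Real.pi / 2 * z) := by
  simpa using sub_smul_dslope (fun w => sinh (Real.pi / 2 * w)) 0 z

lemma dslope_sinh_ne_zero {z : ℂ} (hz : |z.im| < 2) :
    dslope (fun w => sinh (Real.pi / 2 * w)) 0 z ≠ 0 := by
  rcases eq_or_ne z 0 with rfl | hz0
  · rw [dslope_sinh_zero]
    simp [Real.pi_ne_zero]
  · refine right_ne_zero_of_mul (a := z) ?_
    rw [mul_dslope_sinh]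
    exact sinh_half_pi_mul_ne_zero hz hz0

lemma invSinhc_zero : invSinhc 0 = (Real.pi / 2 : ℝ)⁻¹ := by
  rw [invSinhc, dslope_sinh_zero]
  push_cast
  rfl

lemma invSinhc_mul_sinh {z : ℂ} (hz : |z.im| < 2) : invSinhc z * sinh (Real.pi / 2 * z) = z := by
  rw [invSinhc, ← mul_dslope_sinh, mul_left_comm, inv_mul_cancel₀ (dslope_sinh_ne_zero hz), mul_one]

lemma invSinhc_eq_div {z : ℂ} (hz : |z.im| < 2) (hz0 : z ≠ 0) :
    invSinhc z = z / sinh (Real.pi / 2 * z) :=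
  eq_div_of_mul_eq (sinh_half_pi_mul_ne_zero hz hz0) (invSinhc_mul_sinh hz)

lemma differentiableAt_invSinhc {z : ℂ} (hz : |z.im| < 2) : DifferentiableAt ℂ invSinhc z := by
  have h : DifferentiableOn ℂ (dslope (fun w => sinh (Real.pi / 2 * w)) 0) Set.univ :=
    (differentiableOn_dslope Filter.univ_mem).2 (by fun_prop)
  exact (h.differentiableAt Filter.univ_mem).inv (dslope_sinh_ne_zero hz)

lemma invSinhc_ofReal (t : ℝ) : ∃ r : ℝ, 0 < r ∧ invSinhc t = r := by
  rcases eq_or_ne t 0 with rfl | ht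
  · exact ⟨(Real.pi / 2)⁻¹, by positivity, by simpa using invSinhc_zero⟩
  · refine ⟨t / Real.sinh (Real.pi / 2 * t), ?_, ?_⟩
    · have hpi := Real.pi_pos
      rcases ht.lt_or_gt with h | h
      · exact div_pos_of_neg_of_neg h
          (Real.sinh_neg_iff.2 (mul_neg_of_pos_of_neg (by positivity) h))
      · exact div_pos h (Real.sinh_pos_iff.2 (by positivity))
    · rw [invSinhc_eq_div (by simp) (by simpa using ht)]
      push_cast
      rfl

lemma invSinhc_conj {z : ℂ} (hz : |z.im| < 2) :
    invSinhc (starRingEnd ℂ z) = starRingEnd ℂ (invSinhc z) := by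
  rcases eq_or_ne z 0 with rfl | hz0
  · rw [map_zero, invSinhc_zero, conj_ofReal]
  · rw [invSinhc_eq_div (by simpa using hz) (by simpa using hz0), invSinhc_eq_div hz hz0, map_div₀,
      ← sinh_conj]
    simp [map_ofNat]

lemma norm_cosh_le (z : ℂ) : ‖cosh z‖ ≤ Real.exp |z.re| := by
  have h1 : ‖exp z‖ ≤ Real.exp |z.re| := by rw [norm_exp]; gcongr; exact le_abs_self _
  have h2 : ‖exp (-z)‖ ≤ Real.exp |z.re| := by rw [norm_exp]; gcongr; exact neg_le_abs _
  have h := norm_add_le (exp z) (exp (-z))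
  rw [cosh, norm_div, Complex.norm_ofNat]
  linarith

lemma exp_abs_re_le_of_norm {z w : ℂ} (hz : 1 ≤ |z.re|)
    (hw : |‖exp z‖ - ‖exp (-z)‖| ≤ 2 * ‖w‖) : Real.exp |z.re| ≤ 4 * ‖w‖ := by
  have h1 : 2 * Real.exp (-|z.re|) ≤ Real.exp |z.re| := by
    rw [Real.exp_neg, ← div_eq_mul_inv, div_le_iff₀ (Real.exp_pos _), ← Real.exp_add]
    linarith [Real.add_one_le_exp (|z.re| + |z.re|)]
  rw [norm_exp, norm_exp, neg_re, abs_le] at hw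
  rcases abs_cases z.re with ⟨h, _⟩ | ⟨h, _⟩ <;> rw [h] at h1 ⊢
  · linarith [hw.2]
  · rw [neg_neg] at h1
    linarith [hw.1]

lemma exp_abs_re_le_norm_sinh {z : ℂ} (hz : 1 ≤ |z.re|) : Real.exp |z.re| ≤ 4 * ‖sinh z‖ := by
  refine exp_abs_re_le_of_norm hz ((abs_norm_sub_norm_le _ _).trans_eq ?_)
  rw [sinh, norm_div, Complex.norm_ofNat]
  ring

lemma exp_abs_re_le_norm_cosh {z : ℂ} (hz : 1 ≤ |z.re|) : Real.exp |z.re| ≤ 4 * ‖cosh z‖ := by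
  refine exp_abs_re_le_of_norm hz ?_
  have h := abs_norm_sub_norm_le (exp z) (-exp (-z))
  rw [norm_neg, sub_neg_eq_add] at h
  refine h.trans_eq ?_
  rw [cosh, norm_div, Complex.norm_ofNat]
  ring

/-- If `F` has size at least `exp |Re w| / 4` at `w = π (z - a) / 2`, its inverse decays. -/
lemma inv_norm_le_of_exp_le {a z F : ℂ}
    (hF : Real.exp |(Real.pi / 2 * (z - a)).re| ≤ 4 * ‖F‖) :
    ‖F‖⁻¹ ≤ 4 * Real.exp (Real.pi / 2 * |a.re|) * Real.exp (-(Real.pi / 2) * |z.re|) := by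
  have hre : (Real.pi / 2 * (z - a)).re = Real.pi / 2 * (z.re - a.re) := by
    rw [show (Real.pi / 2 : ℂ) = ((Real.pi / 2 : ℝ) : ℂ) by push_cast; rfl, re_ofReal_mul, sub_re]
  have hpi := Real.pi_pos
  have h1 : Real.pi / 2 * |z.re| - Real.pi / 2 * |a.re| ≤ |(Real.pi / 2 * (z - a)).re| := by
    rw [hre, abs_mul, abs_of_pos (half_pos hpi), ← mul_sub]
    gcongr
    exact abs_sub_abs_le_abs_sub _ _
  have h2 := (Real.exp_le_exp.2 h1).trans hF
  have h3 : 0 < ‖F‖ := by linarith [Real.exp_pos (Real.pi / 2 * |z.re| - Real.pi / 2 * |a.re|)]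
  rw [inv_le_iff_one_le_mul₀ h3, mul_assoc 4, ← Real.exp_add,
    show Real.pi / 2 * |a.re| + -(Real.pi / 2) * |z.re| =
    -(Real.pi / 2 * |z.re| - Real.pi / 2 * |a.re|) by ring, Real.exp_neg]
  rw [mul_right_comm, ← div_eq_mul_inv, one_le_div (Real.exp_pos _)]
  exact h2

lemma one_le_abs_re_of_le {a z : ℂ} (hz : |a.re| + 1 ≤ |z.re|) :
    1 ≤ |(Real.pi / 2 * (z - a)).re| := by
  rw [show (Real.pi / 2 : ℂ) = ((Real.pi / 2 : ℝ) : ℂ) by push_cast; rfl, re_ofReal_mul, sub_re,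
    abs_mul, abs_of_pos Real.pi_div_two_pos]
  have h1 := abs_sub_abs_le_abs_sub z.re a.re
  have h2 := Real.pi_gt_three
  nlinarith

lemma expDecay_exp_neg (c d : ℝ) : ExpDecay d fun z => ((c * Real.exp (-d * |z.re|) : ℝ) : ℂ) :=
  ExpDecay.of_bound (C := |c|) fun z _ => by
    rw [norm_real, norm_mul, Real.norm_eq_abs, Real.norm_of_nonneg (Real.exp_pos _).le]

lemma abs_im_sub_lt {a z : ℂ} (ha : |a.im| < 1) (hz : |z.im| ≤ 1) : |(z - a).im| < 2 := by
  rw [sub_im]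
  linarith [abs_sub z.im a.im]

lemma expDecay_invSinhc {a : ℂ} (ha : |a.im| < 1) :
    ExpDecay (Real.pi / 2) fun z => invSinhc (z - a) := by
  have hg : ExpDecay (Real.pi / 2) fun z => (z - a) *
      ((4 * Real.exp (Real.pi / 2 * |a.re|) * Real.exp (-(Real.pi / 2) * |z.re|) : ℝ) : ℂ) := by
    have ha' : ExpDecay 0 fun z => z - a := by
      simpa only [sub_eq_add_neg] using ExpDecay.id.add (ExpDecay.const (-a))
    simpa only [zero_add] using ha'.mul (expDecay_exp_neg
      (4 * Real.exp (Real.pi / 2 * |a.re|)) (Real.pi / 2))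
  refine hg.of_le (M := |a.re| + 1) (fun z hz => ?_) fun z hz hM => ?_
  · exact ContinuousAt.comp (f := fun z => z - a)
      (differentiableAt_invSinhc (abs_im_sub_lt ha hz)).continuousAt (by fun_prop)
  · have h0 : z - a ≠ 0 := fun h => by
      have := one_le_abs_re_of_le hM
      norm_num [h] at this
    rw [invSinhc_eq_div (abs_im_sub_lt ha hz) h0, norm_div, div_eq_mul_inv, norm_mul, norm_real]
    gcongr
    exact (inv_norm_le_of_exp_le (exp_abs_re_le_norm_sinh (one_le_abs_re_of_le hM))).trans
      (le_abs_self _)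

lemma sinh_add_I (t : ℝ) (a : ℂ) :
    sinh (Real.pi / 2 * (t + I - a)) = I * cosh (Real.pi / 2 * (t - a)) := by
  rw [show (Real.pi / 2 * (t + I - a) : ℂ) = Real.pi / 2 * (t - a) + Real.pi / 2 * I by ring,
    sinh_add, cosh_mul_I, sinh_mul_I, cos_pi_div_two, sin_pi_div_two]
  ring

lemma sinh_sub_I (t : ℝ) (a : ℂ) :
    sinh (Real.pi / 2 * (t - I - a)) = -I * cosh (Real.pi / 2 * (t - a)) := by
  rw [show (Real.pi / 2 * (t - I - a) : ℂ) = Real.pi / 2 * (t - a) - Real.pi / 2 * I by ring,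
    sinh_sub, cosh_mul_I, sinh_mul_I, cos_pi_div_two, sin_pi_div_two]
  ring

lemma cosh_half_pi_ne_zero {a : ℂ} (ha : |a.im| < 1) (t : ℝ) :
    cosh (Real.pi / 2 * (t - a)) ≠ 0 := by
  refine right_ne_zero_of_mul (a := I) ?_
  rw [← sinh_add_I]
  refine sinh_half_pi_mul_ne_zero (abs_im_sub_lt ha (by simp)) fun h => ?_
  have := congrArg im h
  simp at this
  rw [abs_lt] at ha
  linarith

lemma expDecay_inv_cosh {a : ℂ} (ha : |a.im| < 1) :
    ExpDecay (Real.pi / 2) fun z => ((‖cosh (Real.pi / 2 * (z.re - a))‖⁻¹ : ℝ) : ℂ) := by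
  refine (expDecay_exp_neg (4 * Real.exp (Real.pi / 2 * |a.re|)) (Real.pi / 2)).of_le
    (M := |a.re| + 1) (fun z hz => ?_) fun z hz hM => ?_
  · have h : Continuous fun z : ℂ => ‖cosh (Real.pi / 2 * (z.re - a))‖⁻¹ :=
      Continuous.inv₀ (by fun_prop) fun z => norm_ne_zero_iff.2 (cosh_half_pi_ne_zero ha _)
    exact (continuous_ofReal.comp h).continuousAt
  · rw [norm_real, norm_real, norm_inv, norm_norm]
    have hM' : |a.re| + 1 ≤ |((z.re : ℝ) : ℂ).re| := by simpa using hM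
    refine (inv_norm_le_of_exp_le (exp_abs_re_le_norm_cosh (one_le_abs_re_of_le hM'))).trans ?_
    rw [ofReal_re]
    exact le_abs_self _

/-- `a` and `b` are the roots of a real quadratic polynomial. -/
def IsRealPair (a b : ℂ) : Prop := (a.im = 0 ∧ b.im = 0) ∨ b = starRingEnd ℂ a

lemma IsRealPair.mul_eq_norm {a b : ℂ} (hab : IsRealPair a b) {F : ℂ → ℂ} (t : ℝ)
    (hreal : ∀ t : ℝ, ∃ r : ℝ, 0 < r ∧ F t = r)
    (hconj : F (starRingEnd ℂ (t - a)) = starRingEnd ℂ (F (t - a))) :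
    F (t - a) * F (t - b) = ((‖F (t - a)‖ * ‖F (t - b)‖ : ℝ) : ℂ) := by
  rcases hab with ⟨ha, hb⟩ | rfl
  · have h : ∀ a : ℂ, a.im = 0 → F (t - a) = ((‖F (t - a)‖ : ℝ) : ℂ) := fun a ha => by
      obtain ⟨r, hr, e⟩ := hreal (t - a.re)
      have : (t - a : ℂ) = ((t - a.re : ℝ) : ℂ) := by
        apply Complex.ext <;> simp [ha]
      rw [this, e, norm_real, Real.norm_of_nonneg hr.le]
    rw [ofReal_mul, ← h a ha, ← h b hb]
  · rw [map_sub, conj_ofReal] at hconj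
    rw [hconj, mul_conj, normSq_eq_norm_sq, norm_conj, sq]

lemma IsRealPair.abs_im {a b : ℂ} (hab : IsRealPair a b) (ha : |a.im| < 1) : |b.im| < 1 := by
  rcases hab with ⟨_, hb⟩ | rfl
  · simp [hb]
  · simpa using ha

/-- A pair of roots in the open strip `|Im z| < 1` has a decaying kernel. -/
lemma isShiftKernel_pair {a b : ℂ} (hab : IsRealPair a b) (ha : |a.im| < 1) :
    IsShiftKernel ((X - C a) * (X - C b)) (-1) Real.pi
      (fun z => invSinhc (z - a) * invSinhc (z - b))
      (fun t => ‖cosh (Real.pi / 2 * (t - a))‖⁻¹ * ‖cosh (Real.pi / 2 * (t - b))‖⁻¹) := by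
  have hb := hab.abs_im ha
  have hcosh : ∀ t : ℝ, cosh (Real.pi / 2 * (t - a)) * cosh (Real.pi / 2 * (t - b)) =
      ((‖cosh (Real.pi / 2 * (t - a))‖ * ‖cosh (Real.pi / 2 * (t - b))‖ : ℝ) : ℂ) := fun t => by
    refine hab.mul_eq_norm (F := fun z => cosh (Real.pi / 2 * z)) t (fun t => ?_) ?_
    · exact ⟨Real.cosh (Real.pi / 2 * t), Real.cosh_pos _, by push_cast; rfl⟩
    · rw [← cosh_conj]
      simp [map_ofNat]
  have hcont : ∀ {a : ℂ}, |a.im| < 1 →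
      Continuous fun t : ℝ => ‖cosh (Real.pi / 2 * (t - a))‖⁻¹ := fun ha =>
    Continuous.inv₀ (by fun_prop) fun t => norm_ne_zero_iff.2 (cosh_half_pi_ne_zero ha t)
  have hne : ∀ {z : ℂ}, |z.im| ≤ 1 → |(z - a).im| < 2 ∧ |(z - b).im| < 2 := fun hz =>
    ⟨abs_im_sub_lt ha hz, abs_im_sub_lt hb hz⟩
  have hpi : Real.pi = Real.pi / 2 + Real.pi / 2 := by ring
  refine ⟨fun z hz => ?_, fun t => ?_, (hcont ha).mul (hcont hb), fun t => ?_, fun t => ?_,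
    fun t => ?_, ?_, ?_⟩
  · have h : ∀ c : ℂ, |(z - c).im| < 2 → DifferentiableAt ℂ (fun z => invSinhc (z - c)) z :=
      fun c hc => DifferentiableAt.comp (f := fun z => z - c) z (differentiableAt_invSinhc hc)
        (by fun_prop)
    exact (h a (hne hz).1).mul (h b (hne hz).2)
  · refine ⟨_, ?_, hab.mul_eq_norm t invSinhc_ofReal (invSinhc_conj (hne (by simp)).1)⟩
    have h : ∀ z : ℂ, |z.im| < 2 → 0 < ‖invSinhc z‖ := fun z hz =>
      norm_pos_iff.2 (inv_ne_zero (dslope_sinh_ne_zero hz))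
    exact mul_pos (h _ (hne (by simp)).1) (h _ (hne (by simp)).2)
  · exact mul_pos (inv_pos.2 (norm_pos_iff.2 (cosh_half_pi_ne_zero ha t)))
      (inv_pos.2 (norm_pos_iff.2 (cosh_half_pi_ne_zero hb t)))
  · obtain ⟨h1, h2⟩ := hne (z := t + I) (by simp)
    have e1 := invSinhc_mul_sinh h1
    have e2 := invSinhc_mul_sinh h2
    rw [sinh_add_I] at e1 e2
    rw [← mul_inv, ofReal_inv, ← hcosh, ← div_eq_mul_inv, eq_div_iff (mul_ne_zero
      (cosh_half_pi_ne_zero ha t) (cosh_half_pi_ne_zero hb t))]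
    simp only [eval_mul, eval_sub, eval_X, eval_C]
    push_cast
    linear_combination (-(t + I - b) : ℂ) * e1 -
      invSinhc (t + I - a) * I * cosh (Real.pi / 2 * (t - a)) * e2 +
      invSinhc (t + I - a) * invSinhc (t + I - b) *
        cosh (Real.pi / 2 * (t - a)) * cosh (Real.pi / 2 * (t - b)) * I_sq
  · obtain ⟨h1, h2⟩ := hne (z := t - I) (by simp)
    have e1 := invSinhc_mul_sinh h1
    have e2 := invSinhc_mul_sinh h2
    rw [sinh_sub_I] at e1 e2
    rw [← mul_inv, ofReal_inv, ← hcosh, ← div_eq_mul_inv, eq_div_iff (mul_ne_zero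
      (cosh_half_pi_ne_zero ha t) (cosh_half_pi_ne_zero hb t))]
    simp only [eval_mul, eval_sub, eval_X, eval_C]
    push_cast
    linear_combination (-(t - I - b) : ℂ) * e1 +
      invSinhc (t - I - a) * I * cosh (Real.pi / 2 * (t - a)) * e2 +
      invSinhc (t - I - a) * invSinhc (t - I - b) *
        cosh (Real.pi / 2 * (t - a)) * cosh (Real.pi / 2 * (t - b)) * I_sq
  · rw [hpi]
    exact (expDecay_invSinhc ha).mul (expDecay_invSinhc hb)
  · rw [hpi]
    simpa using (expDecay_inv_cosh ha).mul (expDecay_inv_cosh hb)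

lemma isShiftKernel_cosh : IsShiftKernel 1 (-1) (-Real.pi) (fun z => cosh (Real.pi * z))
    (fun t => Real.cosh (Real.pi * t)) where
  differentiableAt z _ := by fun_prop
  pos t := ⟨Real.cosh (Real.pi * t), Real.cosh_pos _, by push_cast; rfl⟩
  continuous := by fun_prop
  pos_weight t := Real.cosh_pos _
  add_I t := by
    rw [mul_add, cosh_add, cosh_mul_I, sinh_mul_I, cos_pi, sin_pi]
    simp
  sub_I t := by
    rw [mul_sub, cosh_sub, cosh_mul_I, sinh_mul_I, cos_pi, sin_pi]
    simp
  expDecay := ExpDecay.of_bound (C := 1) fun z _ => by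
    refine (norm_cosh_le _).trans_eq ?_
    rw [re_ofReal_mul, abs_mul, abs_of_pos Real.pi_pos, one_mul, neg_neg]
  expDecay_weight := ExpDecay.of_bound (C := 1) fun z _ => by
    rw [ofReal_cosh]
    refine (norm_cosh_le _).trans_eq ?_
    rw [ofReal_re, abs_mul, abs_of_pos Real.pi_pos, one_mul, neg_neg]

lemma isShiftKernel_of_pos {p : ℂ[X]} (hp : ∀ t : ℝ, ∃ r : ℝ, 0 < r ∧ p.eval (t : ℂ) = r) :
    IsShiftKernel p 1 0 (fun z => p.eval z) (fun _ => 1) where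
  differentiableAt z _ := p.differentiableAt
  pos := hp
  continuous := continuous_const
  pos_weight _ := one_pos
  add_I t := by simp
  sub_I t := by simp
  expDecay := ExpDecay.eval p
  expDecay_weight := by simpa using ExpDecay.const 1

/-- Existence of a shift kernel. -/
def HasShiftKernel (p : ℂ[X]) (s σ : ℝ) : Prop := ∃ Φ κ, IsShiftKernel p s σ Φ κ

lemma HasShiftKernel.mul {p q : ℂ[X]} {s s' σ σ' : ℝ} (h : HasShiftKernel p s σ)
    (h' : HasShiftKernel q s' σ') : HasShiftKernel (p * q) (s * s') (σ + σ') := by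
  obtain ⟨Φ, κ, h⟩ := h
  obtain ⟨Φ', κ', h'⟩ := h'
  exact ⟨_, _, h.mul h'⟩

/-- A monic real quadratic with a root in the strip has a decaying kernel. -/
lemma hasShiftKernel_quadratic_of_root {q : ℝ[X]} (hq : IsMonicOfDegree q 2) {z : ℂ}
    (hz : (q.map ofRealHom).IsRoot z) (hz1 : |z.im| < 1) :
    HasShiftKernel (q.map ofRealHom) (-1) Real.pi := by
  obtain ⟨a, b, rfl⟩ := isMonicOfDegree_two_iff'.1 hq
  have h0 : z ^ 2 - a * z + b = 0 := by simpa [IsRoot.def] using hz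
  have hab : IsRealPair z (a - z) := by
    by_cases him : z.im = 0
    · exact Or.inl ⟨him, by simp [him]⟩
    · have h1 : starRingEnd ℂ z ^ 2 - a * starRingEnd ℂ z + b = 0 := by
        simpa using congrArg (starRingEnd ℂ) h0
      have h2 : (z - starRingEnd ℂ z) * (a - z - starRingEnd ℂ z) = 0 := by
        linear_combination h1 - h0
      refine Or.inr (sub_eq_zero.1 ((mul_eq_zero.1 h2).resolve_left fun h => him ?_))
      exact conj_eq_iff_im.1 (sub_eq_zero.1 h).symm
  have hfac : (X ^ 2 - C a * X + C b : ℝ[X]).map ofRealHom = (X - C z) * (X - C (a - z)) := by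
    have hb : (b : ℂ) = z * (a - z) := by linear_combination h0
    simp [hb]
    ring
  rw [hfac]
  exact ⟨_, _, isShiftKernel_pair hab hz1⟩

lemma hasShiftKernel_quadratic {q : ℝ[X]} (hq : IsMonicOfDegree q 2) :
    HasShiftKernel (q.map ofRealHom) 1 0 := by
  by_cases h : ∃ t : ℝ, q.IsRoot t
  · obtain ⟨t, ht⟩ := h
    have h1 := hasShiftKernel_quadratic_of_root hq (z := t) (IsRoot.map (f := ofRealHom) ht)
      (by simp)
    simpa using h1.mul ⟨_, _, isShiftKernel_cosh⟩
  · obtain ⟨a, b, rfl⟩ := isMonicOfDegree_two_iff'.1 hq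
    simp only [IsRoot.def, eval_add, eval_sub, eval_pow, eval_X, eval_mul, eval_C] at h
    have hdisc : 0 < b - a ^ 2 / 4 := by
      by_contra! hneg
      refine h ⟨a / 2 + √(a ^ 2 / 4 - b), ?_⟩
      have := Real.sq_sqrt (show 0 ≤ a ^ 2 / 4 - b by linarith)
      linear_combination this
    refine ⟨_, _, isShiftKernel_of_pos fun t => ⟨t ^ 2 - a * t + b, ?_, by simp⟩⟩
    nlinarith [sq_nonneg (t - a / 2)]

lemma hasShiftKernel_of_isMonicOfDegree (m : ℕ) : ∀ {q : ℝ[X]}, IsMonicOfDegree q (2 * m) →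
    HasShiftKernel (q.map ofRealHom) 1 0 := by
  induction m with
  | zero =>
    intro q hq
    rw [isMonicOfDegree_zero_iff.1 hq, Polynomial.map_one]
    exact ⟨_, _, isShiftKernel_of_pos fun t => ⟨1, one_pos, by simp⟩⟩
  | succ m ih =>
    intro q hq
    obtain ⟨f, g, hf, hg, rfl⟩ := hq.eq_isMonicOfDegree_two_mul_isMonicOfDegree
    simpa using (hasShiftKernel_quadratic hf).mul (ih hg)

theorem hasShiftKernel_of_root (m : ℕ) : ∀ {q : ℝ[X]}, IsMonicOfDegree q (2 * m) →
    ∀ {z : ℂ}, (q.map ofRealHom).IsRoot z → |z.im| < 1 →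
    HasShiftKernel (q.map ofRealHom) (-1) Real.pi := by
  induction m with
  | zero =>
    intro q hq z hz _
    rw [isMonicOfDegree_zero_iff.1 hq] at hz
    simp at hz
  | succ m ih =>
    intro q hq z hz hz1
    obtain ⟨f, g, hf, hg, rfl⟩ := hq.eq_isMonicOfDegree_two_mul_isMonicOfDegree
    rw [Polynomial.map_mul] at hz ⊢
    rcases root_mul.1 hz with h | h
    · simpa using (hasShiftKernel_quadratic_of_root hf h hz1).mul
        (hasShiftKernel_of_isMonicOfDegree m hg)
    · simpa using (hasShiftKernel_quadratic hf).mul (ih hg h hz1)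

/-- The restriction to the imaginary axis of a polynomial real there is a monic real polynomial
if the leading coefficient has the right sign. -/
lemma RealOnIm.exists_real {m : ℕ} {P : ℂ[X]} (hP : RealOnIm P) (hdeg : P.natDegree = 2 * m)
    (hlead : P.leadingCoeff = (-1 : ℂ) ^ m) :
    ∃ q : ℝ[X], IsMonicOfDegree q (2 * m) ∧ q.map ofRealHom = P.comp (C I * X) := by
  have hnat : (C I * X : ℂ[X]).natDegree = 1 := natDegree_C_mul_X I I_ne_zero
  have hmonic : (P.comp (C I * X)).Monic := by
    rw [Monic, leadingCoeff_comp (by rw [hnat]; exact one_ne_zero), leadingCoeff_C_mul_X, hdeg,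
      hlead, pow_mul, I_sq, ← mul_pow]
    simp
  have hconj : (P.comp (C I * X)).map (starRingEnd ℂ) = P.comp (C I * X) := by
    conv_rhs => rw [← hP.pstar_eq, pstar_apply, comp_assoc]
    rw [map_comp]
    simp
  have hlift : P.comp (C I * X) ∈ lifts ofRealHom := by
    rw [lifts_iff_coeff_lifts]
    intro n
    have h := congrArg (fun q => coeff q n) hconj
    simp only [coeff_map] at h
    exact ⟨_, conj_eq_iff_re.1 h⟩
  obtain ⟨q, hq, hqdeg, hqm⟩ := lifts_and_natDegree_eq_and_monic hlift hmonic
  refine ⟨q, ⟨?_, hqm⟩, hq⟩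
  rw [hqdeg, natDegree_comp, hnat, hdeg, mul_one]

end Kernels

/-- if `P` has even degree `n = 2m`, leading coefficient `(−1)^m`, is real on
the imaginary axis, and has a root `α` with `|Re α| < 1`, then `𝒜(P)` is unitarizable. -/
theorem stmt1 (m : ℕ) (hm : 1 ≤ m) (P : ℂ[X]) (hdeg : P.natDegree = 2 * m)
    (hlead : P.leadingCoeff = (-1 : ℂ) ^ m) (hreal : RealOnIm P)
    (hroot : ∃ α ∈ P.roots, |α.re| < 1) :
    Unitarizable P := by
  obtain ⟨α, hα, hα1⟩ := hroot
  obtain ⟨q, hq, hqP⟩ := hreal.exists_real hdeg hlead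
  have hP0 : P ≠ 0 := by
    rintro rfl
    simp at hα
  have hz : (q.map Complex.ofRealHom).IsRoot (-Complex.I * α) := by
    rw [hqP, IsRoot.def, eval_comp, eval_mul, eval_C, eval_X, ← mul_assoc, mul_neg,
      Complex.I_mul_I, neg_neg, one_mul]
    exact (mem_roots hP0).1 hα
  obtain ⟨Φ, κ, h⟩ := hasShiftKernel_of_root m hq hz (by simpa using hα1)
  rw [hqP] at h
  exact (h.isPositiveTrace Real.pi_pos).unitarizable hreal.pstar_eq hP0

end
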